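/- Let S = {x₁,…,x₁₂} be twelve distinct points of P² such that no line contains 5 or more points of S and no conic (irreducible or reducible) contains 8 or more points of S. Suppose C is an irreducible homogeneous polynomial of degree 2 whose zero set contains exactly the points x₁,…,x₇ of S, suppose L is a line containing exactly the points x₈,…,x₁₁ of S, and suppose x₁₂ does not lie on the zero set of C nor on L. Let p ∈ P² be a point with p ∉ S, p ≠ x₁₂, and p not lying on the zero set of C nor on L. Then there exist nonzero homogeneous polynomials P, Q ∈ ℂ[X,Y,Z] of degree 4, having no common nonconstant factor in ℂ[X,Y,Z], such that Σ_{x ∈ S ∪ {p}} min(ord_x(P), ord_x(Q)) ≥ 12, where ord_x denotes the vanishing order at x. -/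

import Mathlib

open MvPolynomial

/-- The iterated partial derivative of `F` corresponding to the multi-index `m`. -/
noncomputable def pderivMulti (m : Fin 3 → ℕ) (F : MvPolynomial (Fin 3) ℂ) :
    MvPolynomial (Fin 3) ℂ :=
  (fun G => pderiv (0 : Fin 3) G)^[m 0]
    ((fun G => pderiv (1 : Fin 3) G)^[m 1]
      ((fun G => pderiv (2 : Fin 3) G)^[m 2] F))

/-- The vanishing order of `F` at a point `x` of the projective plane: the largest `k`
such that all partial derivatives of `F` of total order `< k` vanish at `x`. -/
noncomputable def ordAt (F : MvPolynomial (Fin 3) ℂ)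
    (x : Projectivization ℂ (Fin 3 → ℂ)) : ℕ :=
  sSup {k : ℕ | ∀ m : Fin 3 → ℕ, m 0 + m 1 + m 2 < k →
    eval x.rep (pderivMulti m F) = 0}


/-- Iterated derivative: coefficient formula. -/
lemma coeff_iter_pderiv (i : Fin 3) (k : ℕ) : ∀ (F : MvPolynomial (Fin 3) ℂ) (e : Fin 3 →₀ ℕ),
    ∃ c : ℕ, c ≠ 0 ∧ coeff e ((fun G => pderiv i G)^[k] F)
      = c * coeff (e + Finsupp.single i k) F := by
  induction k with
  | zero => intro F e; exact ⟨1, one_ne_zero, by simp⟩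
  | succ k ih =>
    intro F e
    obtain ⟨c, hc, h⟩ := ih F (e + Finsupp.single i 1)
    refine ⟨c * (e i + 1), by positivity, ?_⟩
    rw [Function.iterate_succ_apply', coeff_pderiv, h, add_assoc, ← Finsupp.single_add,
      add_comm 1 k]
    push_cast
    ring

lemma homog_iter_pderiv (i : Fin 3) (k : ℕ) : ∀ (n : ℕ) (F : MvPolynomial (Fin 3) ℂ),
    F.IsHomogeneous n → ((fun G => pderiv i G)^[k] F).IsHomogeneous (n - k) := by
  induction k with
  | zero => intro n F h; simpa using h
  | succ k ih =>
    intro n F h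
    rw [Function.iterate_succ_apply']
    exact (ih n F h).pderiv

lemma one_le_ordAt {F : MvPolynomial (Fin 3) ℂ} {n : ℕ} (hF : F ≠ 0) (hh : F.IsHomogeneous n)
    (y : Projectivization ℂ (Fin 3 → ℂ)) (hy : eval y.rep F = 0) : 1 ≤ ordAt F y := by
  obtain ⟨d, hd⟩ := MvPolynomial.ne_zero_iff.mp hF
  have hdeg : d.degree = n := by
    by_contra h
    exact hd (hh.coeff_eq_zero h)
  have hsum : d 0 + d 1 + d 2 = n := by
    rw [← hdeg, Finsupp.degree_eq_sum, Fin.sum_univ_three]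
  have hne : eval y.rep (pderivMulti d F) ≠ 0 := by
    have h0 : (pderivMulti d F).IsHomogeneous 0 := by
      have := homog_iter_pderiv 0 (d 0) _ _ (homog_iter_pderiv 1 (d 1) _ _
        (homog_iter_pderiv 2 (d 2) _ _ hh))
      have e : n - d 2 - d 1 - d 0 = 0 := by omega
      rw [e] at this
      exact this
    have hc : pderivMulti d F = C (coeff 0 (pderivMulti d F)) := by
      rw [← totalDegree_eq_zero_iff_eq_C]
      exact Nat.le_zero.mp h0.totalDegree_le
    rw [hc, eval_C]
    obtain ⟨a, ha, h1⟩ := coeff_iter_pderiv 0 (d 0) ((fun G => pderiv (1 : Fin 3) G)^[d 1]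
      ((fun G => pderiv (2 : Fin 3) G)^[d 2] F)) 0
    obtain ⟨b, hb, h2⟩ := coeff_iter_pderiv 1 (d 1)
      ((fun G => pderiv (2 : Fin 3) G)^[d 2] F) (0 + Finsupp.single 0 (d 0))
    obtain ⟨c, hc, h3⟩ := coeff_iter_pderiv 2 (d 2) F
      (0 + Finsupp.single 0 (d 0) + Finsupp.single 1 (d 1))
    have hdd : (0 + Finsupp.single 0 (d 0) + Finsupp.single 1 (d 1) + Finsupp.single 2 (d 2)
        : Fin 3 →₀ ℕ) = d := by
      ext i
      fin_cases i <;> simp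
    unfold pderivMulti
    rw [h1, h2, h3, hdd]
    simp [ha, hb, hc, hd]
  unfold ordAt
  refine le_csSup ⟨n, ?_⟩ ?_
  · intro k hk
    by_contra hlt
    exact hne (hk d (by omega))
  · intro m hm
    have h0 : m 0 = 0 := by omega
    have h1 : m 1 = 0 := by omega
    have h2 : m 2 = 0 := by omega
    simp [pderivMulti, h0, h1, h2, hy]

lemma exists_homog_quot {F G q : MvPolynomial (Fin 3) ℂ} {m n : ℕ} (hF : F.IsHomogeneous (m + n))
    (hG : G.IsHomogeneous m) (h : F = G * q) : ∃ r, r.IsHomogeneous n ∧ F = G * r := by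
  let _ := MvPolynomial.gradedAlgebra (σ := Fin 3) (R := ℂ)
  refine ⟨DirectSum.decompose (homogeneousSubmodule (Fin 3) ℂ) q n,
    (mem_homogeneousSubmodule _ _).1 (SetLike.coe_mem _), ?_⟩
  have h1 := DirectSum.coe_decompose_mul_of_left_mem_of_le (homogeneousSubmodule (Fin 3) ℂ)
    (b := q) (n := m + n) ((mem_homogeneousSubmodule m G).2 hG) (Nat.le_add_right m n)
  rw [← h, Nat.add_sub_cancel_left] at h1
  rw [← h1]
  exact (DirectSum.decompose_of_mem_same _ ((mem_homogeneousSubmodule _ F).2 hF)).symm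

abbrev Hom3 (n : ℕ) := homogeneousSubmodule (Fin 3) ℂ n

instance (n : ℕ) : FiniteDimensional ℂ (Hom3 n) :=
  Module.Finite.iff_fg.mpr (homogeneousSubmodule_fg (Fin 3) ℂ n)

lemma finrank_Hom3 (n : ℕ) :
    Module.finrank ℂ (Hom3 n) = (Finset.finsuppAntidiag (Finset.univ : Finset (Fin 3)) n).card := by
  have e : {d : Fin 3 →₀ ℕ | d.degree = n} =
      ↑(Finset.finsuppAntidiag (Finset.univ : Finset (Fin 3)) n) := by
    ext d
    simp [Finset.mem_finsuppAntidiag, Finsupp.degree_eq_sum]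
  rw [Hom3, homogeneousSubmodule_eq_finsupp_supported, e,
    (AddMonoidAlgebra.supportedEquivFinsupp _).finrank_eq, Module.finrank_finsupp_self]
  simp

lemma finrank0 : Module.finrank ℂ (Hom3 0) = 1 := by rw [finrank_Hom3]; decide
lemma finrank1 : Module.finrank ℂ (Hom3 1) = 3 := by rw [finrank_Hom3]; decide
lemma finrank2 : Module.finrank ℂ (Hom3 2) = 6 := by rw [finrank_Hom3]; decide
lemma finrank3 : Module.finrank ℂ (Hom3 3) = 10 := by rw [finrank_Hom3]; decide
lemma finrank4 : Module.finrank ℂ (Hom3 4) = 15 := by rw [finrank_Hom3]; decide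

/-- evaluation at a family of vectors -/
noncomputable def evMap (d n : ℕ) (v : Fin n → (Fin 3 → ℂ)) : Hom3 d →ₗ[ℂ] (Fin n → ℂ) :=
  LinearMap.pi fun i => (aeval (v i)).toLinearMap ∘ₗ (Hom3 d).subtype

lemma evMap_apply (d n : ℕ) (v : Fin n → (Fin 3 → ℂ)) (F : Hom3 d) (i : Fin n) :
    evMap d n v F i = eval (v i) F.1 := by
  simp [evMap, aeval_eq_eval]

noncomputable def mulMap (m n : ℕ) (G : MvPolynomial (Fin 3) ℂ) (hG : G.IsHomogeneous m) :
    Hom3 n →ₗ[ℂ] Hom3 (m + n) :=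
  LinearMap.codRestrict _ (LinearMap.mulLeft ℂ G ∘ₗ (Hom3 n).subtype)
    (fun c => hG.mul c.2)

/-- If points impose independent conditions and the count matches, then every form vanishing
at the points is divisible by `G`. -/
lemma divis (m k n : ℕ) (v : Fin n → (Fin 3 → ℂ)) (G : MvPolynomial (Fin 3) ℂ) (hG0 : G ≠ 0)
    (hG : G.IsHomogeneous m) (hGv : ∀ i, eval (v i) G = 0)
    (hdim : Module.finrank ℂ (Hom3 (m + k)) ≤ Module.finrank ℂ (Hom3 k) + n)
    (f : Fin n → MvPolynomial (Fin 3) ℂ) (hf : ∀ i, (f i).IsHomogeneous (m + k))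
    (hfn : ∀ i, eval (v i) (f i) ≠ 0) (hfz : ∀ i j, i ≠ j → eval (v j) (f i) = 0)
    (F : MvPolynomial (Fin 3) ℂ) (hF : F.IsHomogeneous (m + k)) (hFv : ∀ i, eval (v i) F = 0) :
    ∃ r, r.IsHomogeneous k ∧ F = G * r := by
  have hsurj : Function.Surjective (evMap (m + k) n v) := by
    intro w
    refine ⟨∑ i, (w i / eval (v i) (f i)) • (⟨f i, hf i⟩ : Hom3 (m + k)), ?_⟩
    ext j
    rw [map_sum, Finset.sum_apply, Finset.sum_eq_single j]
    · rw [map_smul, Pi.smul_apply, evMap_apply, smul_eq_mul, div_mul_cancel₀ _ (hfn j)]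
    · intro i _ hij
      rw [map_smul, Pi.smul_apply, evMap_apply, hfz i j hij, smul_zero]
    · simp
  have hinj : Function.Injective (mulMap m k G hG) := by
    intro a b hab
    have : G * a.1 = G * b.1 := congrArg Subtype.val hab
    exact Subtype.ext (mul_left_cancel₀ hG0 this)
  have hle : LinearMap.range (mulMap m k G hG) ≤ LinearMap.ker (evMap (m + k) n v) := by
    rintro _ ⟨a, rfl⟩
    rw [LinearMap.mem_ker]
    ext i
    rw [evMap_apply]
    change eval (v i) (G * a.1) = 0
    rw [map_mul, hGv, zero_mul]
  have h1 := LinearMap.finrank_range_add_finrank_ker (evMap (m + k) n v)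
  rw [LinearMap.range_eq_top.2 hsurj, finrank_top, Module.finrank_fin_fun] at h1
  have h2 := LinearMap.finrank_range_of_inj hinj
  have heq := Submodule.eq_of_le_of_finrank_le hle (by omega)
  have hmem : (⟨F, hF⟩ : Hom3 (m + k)) ∈ LinearMap.ker (evMap (m + k) n v) := by
    rw [LinearMap.mem_ker]
    ext i
    rw [evMap_apply]
    exact hFv i
  rw [← heq] at hmem
  obtain ⟨a, ha⟩ := hmem
  exact ⟨a.1, a.2, (congrArg Subtype.val ha).symm⟩

noncomputable def lin (f : (Fin 3 → ℂ) →ₗ[ℂ] ℂ) : MvPolynomial (Fin 3) ℂ :=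
  ∑ i, C (f (Pi.single i 1)) * X i

lemma eval_lin (f : (Fin 3 → ℂ) →ₗ[ℂ] ℂ) (v : Fin 3 → ℂ) : eval v (lin f) = f v := by
  conv_rhs => rw [← Finset.univ_sum_single v]
  rw [lin, map_sum, map_sum]
  refine Finset.sum_congr rfl fun i _ => ?_
  have : (Pi.single i (v i) : Fin 3 → ℂ) = v i • Pi.single i 1 := by
    rw [← Pi.single_smul]; simp
  rw [this, map_smul]
  simp [mul_comm]

lemma lin_homog (f : (Fin 3 → ℂ) →ₗ[ℂ] ℂ) : (lin f).IsHomogeneous 1 :=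
  IsHomogeneous.sum _ _ _ fun i _ => isHomogeneous_C_mul_X _ i

lemma exists_sep {a b : Projectivization ℂ (Fin 3 → ℂ)} (h : a ≠ b) :
    ∃ l : MvPolynomial (Fin 3) ℂ, l.IsHomogeneous 1 ∧ eval a.rep l = 0 ∧ eval b.rep l ≠ 0 := by
  have hb : b.rep ∉ Submodule.span ℂ {a.rep} := by
    rw [Submodule.mem_span_singleton]
    rintro ⟨c, hc⟩
    apply h
    rw [← a.mk_rep, ← b.mk_rep, eq_comm, Projectivization.mk_eq_mk_iff']
    exact ⟨c, hc⟩
  obtain ⟨f, hf, hk⟩ := Submodule.exists_le_ker_of_notMem hb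
  refine ⟨lin f, lin_homog f, ?_, ?_⟩
  · rw [eval_lin]
    exact hk (Submodule.mem_span_singleton_self _)
  · rwa [eval_lin]

lemma exists_line (a b : Fin 3 → ℂ) :
    ∃ l : MvPolynomial (Fin 3) ℂ, l ≠ 0 ∧ l.IsHomogeneous 1 ∧ eval a l = 0 ∧ eval b l = 0 := by
  have hlt : Submodule.span ℂ ({a, b} : Set (Fin 3 → ℂ)) < ⊤ := by
    refine lt_top_iff_ne_top.2 fun h => ?_
    have h1 := finrank_span_finset_le_card (R := ℂ) ({a, b} : Finset (Fin 3 → ℂ))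
    have h2 := Finset.card_le_two (a := a) (b := b)
    rw [Finset.coe_pair, Set.finrank, h, finrank_top, Module.finrank_fin_fun] at h1
    omega
  obtain ⟨f, hf, hk⟩ := Submodule.exists_le_ker_of_lt_top _ hlt
  refine ⟨lin f, ?_, lin_homog f, ?_, ?_⟩
  · intro h
    apply hf
    ext1 i
    ext
    have := eval_lin f (Pi.single i 1)
    rw [h] at this
    simpa using this.symm
  · rw [eval_lin]; exact hk (Submodule.subset_span (by simp))
  · rw [eval_lin]; exact hk (Submodule.subset_span (by simp))

lemma irr_of_linear {l : MvPolynomial (Fin 3) ℂ} (h0 : l ≠ 0) (h : l.IsHomogeneous 1) :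
    Irreducible l := by
  apply irreducible_of_totalDegree_eq_one (h.totalDegree h0)
  intro c hc
  obtain ⟨d, hd⟩ := MvPolynomial.ne_zero_iff.mp h0
  refine isUnit_iff_ne_zero.2 fun hc0 => hd ?_
  have := hc d
  rwa [hc0, zero_dvd_iff] at this

/-- A conic with three zeros on a line is divisible by the line. -/
lemma line_dvd_conic {a b c : Projectivization ℂ (Fin 3 → ℂ)} (hab : a ≠ b) (hac : a ≠ c)
    (hbc : b ≠ c) {L F : MvPolynomial (Fin 3) ℂ} (hL0 : L ≠ 0) (hL : L.IsHomogeneous 1)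
    (hF : F.IsHomogeneous 2) (hLa : eval a.rep L = 0) (hLb : eval b.rep L = 0)
    (hLc : eval c.rep L = 0) (hFa : eval a.rep F = 0) (hFb : eval b.rep F = 0)
    (hFc : eval c.rep F = 0) : ∃ r, r.IsHomogeneous 1 ∧ F = L * r := by
  obtain ⟨ab, hab1, hab2, hab3⟩ := exists_sep hab
  obtain ⟨ba, hba1, hba2, hba3⟩ := exists_sep hab.symm
  obtain ⟨ac, hac1, hac2, hac3⟩ := exists_sep hac
  obtain ⟨ca, hca1, hca2, hca3⟩ := exists_sep hac.symm
  obtain ⟨bc, hbc1, hbc2, hbc3⟩ := exists_sep hbc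
  obtain ⟨cb, hcb1, hcb2, hcb3⟩ := exists_sep hbc.symm
  refine divis 1 1 3 ![a.rep, b.rep, c.rep] L hL0 hL ?_ ?_ ![ba * ca, ab * cb, ac * bc] ?_ ?_ ?_
    F hF ?_
  · intro i; fin_cases i <;> simpa
  · rw [finrank1, show 1 + 1 = 2 from rfl, finrank2]
  · intro i
    fin_cases i
    · exact hba1.mul hca1
    · exact hab1.mul hcb1
    · exact hac1.mul hbc1
  · intro i; fin_cases i <;> simp [*]
  · intro i j hij
    fin_cases i <;> fin_cases j <;> simp_all
  · intro i; fin_cases i <;> simpa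

/-- A cubic with seven zeros on an irreducible conic is divisible by the conic. -/
lemma conic_dvd_cubic (y : Fin 7 → Projectivization ℂ (Fin 3 → ℂ)) (hy : Function.Injective y)
    {K F : MvPolynomial (Fin 3) ℂ} (hirr : Irreducible K) (hK : K.IsHomogeneous 2)
    (hF : F.IsHomogeneous 3) (hKy : ∀ i, eval (y i).rep K = 0)
    (hFy : ∀ i, eval (y i).rep F = 0) : ∃ r, r.IsHomogeneous 1 ∧ F = K * r := by
  have key : ∀ i j k : Fin 7, i ≠ j → i ≠ k → j ≠ k → ∃ l : MvPolynomial (Fin 3) ℂ,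
      l.IsHomogeneous 1 ∧ eval (y i).rep l = 0 ∧ eval (y j).rep l = 0 ∧
      eval (y k).rep l ≠ 0 := by
    intro i j k hij hik hjk
    obtain ⟨l, hl0, hl, hi, hj⟩ := exists_line (y i).rep (y j).rep
    refine ⟨l, hl, hi, hj, fun hk => ?_⟩
    obtain ⟨r, hr, hKr⟩ := line_dvd_conic (hy.ne hij) (hy.ne hik) (hy.ne hjk) hl0 hl hK hi hj hk
      (hKy i) (hKy j) (hKy k)
    have hr0 : r ≠ 0 := by
      rintro rfl
      exact hirr.ne_zero (by rw [hKr, mul_zero])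
    rcases hirr.isUnit_or_isUnit hKr with h | h
    · exact (irr_of_linear hl0 hl).not_isUnit h
    · exact (irr_of_linear hr0 hr).not_isUnit h
  have h12 : ∀ i : Fin 7, i + 1 ≠ i + 2 ∧ i + 1 ≠ i ∧ i + 2 ≠ i := by decide
  have h34 : ∀ i : Fin 7, i + 3 ≠ i + 4 ∧ i + 3 ≠ i ∧ i + 4 ≠ i := by decide
  have h56 : ∀ i : Fin 7, i + 5 ≠ i + 6 ∧ i + 5 ≠ i ∧ i + 6 ≠ i := by decide
  choose f hf hf1 hf2 hf3 using fun i : Fin 7 =>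
    key (i + 1) (i + 2) i (h12 i).1 (h12 i).2.1 (h12 i).2.2
  choose g hg hg1 hg2 hg3 using fun i : Fin 7 =>
    key (i + 3) (i + 4) i (h34 i).1 (h34 i).2.1 (h34 i).2.2
  choose h hh hh1 hh2 hh3 using fun i : Fin 7 =>
    key (i + 5) (i + 6) i (h56 i).1 (h56 i).2.1 (h56 i).2.2
  refine divis 2 1 7 (fun i => (y i).rep) K hirr.ne_zero hK hKy ?_ (fun i => f i * g i * h i)
    ?_ ?_ ?_ F hF hFy
  · rw [finrank1, show 2 + 1 = 3 from rfl, finrank3]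
  · intro i
    exact ((hf i).mul (hg i)).mul (hh i)
  · intro i
    simp only [map_mul]
    exact mul_ne_zero (mul_ne_zero (hf3 i) (hg3 i)) (hh3 i)
  · intro i j hij
    have cases : ∀ i j : Fin 7, i ≠ j → j = i + 1 ∨ j = i + 2 ∨ j = i + 3 ∨ j = i + 4 ∨
      j = i + 5 ∨ j = i + 6 := by decide
    simp only [map_mul]
    rcases cases i j hij with rfl | rfl | rfl | rfl | rfl | rfl
    · rw [hf1]; ring
    · rw [hf2]; ring
    · rw [hg1]; ring
    · rw [hg2]; ring
    · rw [hh1]; ring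
    · rw [hh2]; ring

/-- A linear form vanishing at two distinct points and at a point off their line is zero. -/
lemma linear_eq_zero {a b : Projectivization ℂ (Fin 3 → ℂ)} (hab : a ≠ b) {w : Fin 3 → ℂ}
    {M l : MvPolynomial (Fin 3) ℂ} (hM0 : M ≠ 0) (hM : M.IsHomogeneous 1)
    (hl : l.IsHomogeneous 1) (hMa : eval a.rep M = 0) (hMb : eval b.rep M = 0)
    (hMw : eval w M ≠ 0) (hla : eval a.rep l = 0) (hlb : eval b.rep l = 0)
    (hlw : eval w l = 0) : l = 0 := by
  obtain ⟨s, hs1, hs2, hs3⟩ := exists_sep hab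
  obtain ⟨t, ht1, ht2, ht3⟩ := exists_sep hab.symm
  obtain ⟨r, hr, hlr⟩ := divis 1 0 2 ![a.rep, b.rep] M hM0 hM
    (by intro i; fin_cases i <;> simpa)
    (by rw [finrank0, show 1 + 0 = 1 from rfl, finrank1]) ![t, s]
    (by intro i; fin_cases i <;> simpa) (by intro i; fin_cases i <;> simpa)
    (by intro i j hij; fin_cases i <;> fin_cases j <;> simp_all) l hl
    (by intro i; fin_cases i <;> simpa)
  have hc : r = C (coeff 0 r) := by
    rw [← totalDegree_eq_zero_iff_eq_C]
    exact Nat.le_zero.mp hr.totalDegree_le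
  rw [hlr, map_mul] at hlw
  have h1 := (mul_eq_zero.1 hlw).resolve_left hMw
  rw [hc, eval_C] at h1
  rw [hlr, hc, h1, C_0, mul_zero]

lemma exists_eval_ne {F : MvPolynomial (Fin 3) ℂ} (h : F ≠ 0) : ∃ w, eval w F ≠ 0 := by
  by_contra! hc
  exact h (MvPolynomial.funext fun w => by simpa using hc w)

theorem exists_quartics_total_weight_ge_twelve
    (x : Fin 12 → Projectivization ℂ (Fin 3 → ℂ)) (hx : Function.Injective x)
    (hline : ∀ l : MvPolynomial (Fin 3) ℂ, l ≠ 0 → l.IsHomogeneous 1 →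
      {y ∈ Set.range x | eval y.rep l = 0}.ncard ≤ 4)
    (hconic : ∀ c : MvPolynomial (Fin 3) ℂ, c ≠ 0 → c.IsHomogeneous 2 →
      {y ∈ Set.range x | eval y.rep c = 0}.ncard ≤ 7)
    (C : MvPolynomial (Fin 3) ℂ) (hCh : C.IsHomogeneous 2) (hCirr : Irreducible C)
    (hCv : ∀ i : Fin 12, eval (x i).rep C = 0 ↔ (i : ℕ) < 7)
    (L : MvPolynomial (Fin 3) ℂ) (hL : L ≠ 0) (hLh : L.IsHomogeneous 1)
    (hLv : ∀ i : Fin 12, eval (x i).rep L = 0 ↔ (7 ≤ (i : ℕ) ∧ (i : ℕ) < 11))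
    (hx12C : eval (x 11).rep C ≠ 0) (hx12L : eval (x 11).rep L ≠ 0)
    (p : Projectivization ℂ (Fin 3 → ℂ))
    (hpS : p ∉ Set.range x) (hpx12 : p ≠ x 11)
    (hpC : eval p.rep C ≠ 0) (hpL : eval p.rep L ≠ 0) :
    ∃ P Q : MvPolynomial (Fin 3) ℂ, P ≠ 0 ∧ Q ≠ 0 ∧
      P.IsHomogeneous 4 ∧ Q.IsHomogeneous 4 ∧
      (¬ ∃ h : MvPolynomial (Fin 3) ℂ, 0 < h.totalDegree ∧ h ∣ P ∧ h ∣ Q) ∧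
      12 ≤ ∑ᶠ y ∈ Set.range x ∪ {p}, min (ordAt P y) (ordAt Q y) := by
  -- auxiliary point `w` off `C`, `L` and the line `M` through `x 11` and `p`
  obtain ⟨M, hM0, hMh, hM11, hMp⟩ := exists_line (x 11).rep p.rep
  obtain ⟨w, hw⟩ := exists_eval_ne (mul_ne_zero (mul_ne_zero hCirr.ne_zero hL) hM0)
  rw [map_mul, map_mul, mul_ne_zero_iff, mul_ne_zero_iff] at hw
  obtain ⟨⟨hwC, hwL⟩, hwM⟩ := hw
  have hno : ∀ r : MvPolynomial (Fin 3) ℂ, r.IsHomogeneous 1 → eval (x 11).rep r = 0 →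
      eval p.rep r = 0 → eval w r = 0 → r = 0 := fun r hr h1 h2 h3 =>
    linear_eq_zero hpx12.symm hM0 hMh hr hM11 hMp hwM h1 h2 h3
  -- a nonzero quartic through the twelve points, `p` and `w`
  obtain ⟨Q, hQ0, hQh, hQx, hQp, hQw⟩ : ∃ Q : MvPolynomial (Fin 3) ℂ, Q ≠ 0 ∧
      Q.IsHomogeneous 4 ∧ (∀ i, eval (x i).rep Q = 0) ∧ eval p.rep Q = 0 ∧ eval w Q = 0 := by
    have hker : LinearMap.ker (evMap 4 14 (Fin.snoc (Fin.snoc (fun i => (x i).rep) p.rep : 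
        Fin 13 → (Fin 3 → ℂ)) w : Fin 14 → (Fin 3 → ℂ))) ≠ ⊥ := by
      apply LinearMap.ker_ne_bot_of_finrank_lt
      rw [finrank4, Module.finrank_fin_fun]
      norm_num
    obtain ⟨q, hq, hq0⟩ := Submodule.exists_mem_ne_zero_of_ne_bot hker
    rw [LinearMap.mem_ker] at hq
    refine ⟨q.1, fun h => hq0 (Subtype.ext h), q.2, fun i => ?_, ?_, ?_⟩
    · have := congrFun hq (i.castSucc).castSucc
      rw [evMap_apply, Fin.snoc_castSucc (α := fun _ => Fin 3 → ℂ),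
        Fin.snoc_castSucc (α := fun _ => Fin 3 → ℂ)] at this
      exact this
    · have := congrFun hq (Fin.last 12).castSucc
      rw [evMap_apply, Fin.snoc_castSucc (α := fun _ => Fin 3 → ℂ),
        Fin.snoc_last (α := fun _ => Fin 3 → ℂ)] at this
      exact this
    · have := congrFun hq (Fin.last 13)
      rw [evMap_apply, Fin.snoc_last (α := fun _ => Fin 3 → ℂ)] at this
      exact this
  have hfin : ∀ r : MvPolynomial (Fin 3) ℂ, r.IsHomogeneous 1 → Q = C * L * r → False := by
    intro r hr hQr
    have h1 := hQx 11
    have h2 := hQp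
    have h3 := hQw
    rw [hQr, map_mul, map_mul] at h1 h2 h3
    have hr0 := hno r hr ((mul_eq_zero.1 h1).resolve_left (mul_ne_zero hx12C hx12L))
      ((mul_eq_zero.1 h2).resolve_left (mul_ne_zero hpC hpL))
      ((mul_eq_zero.1 h3).resolve_left (mul_ne_zero hwC hwL))
    exact hQ0 (by rw [hQr, hr0, mul_zero])
  have hCQ : ¬ C ∣ Q := by
    rintro ⟨q, hq⟩
    obtain ⟨q, hqh, hq⟩ := exists_homog_quot (m := 2) (n := 2) hQh hCh hq
    have hqv : ∀ i : Fin 12, 7 ≤ (i : ℕ) → eval (x i).rep q = 0 := by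
      intro i hi
      have h := hQx i
      rw [hq, map_mul] at h
      exact (mul_eq_zero.1 h).resolve_left fun h' => by have := (hCv i).1 h'; omega
    obtain ⟨r, hr, hqr⟩ := line_dvd_conic (a := x 7) (b := x 8) (c := x 9)
      (hx.ne (by decide)) (hx.ne (by decide)) (hx.ne (by decide)) hL hLh hqh
      ((hLv 7).2 (by decide)) ((hLv 8).2 (by decide)) ((hLv 9).2 (by decide))
      (hqv 7 (by decide)) (hqv 8 (by decide)) (hqv 9 (by decide))
    exact hfin r hr (by rw [hq, hqr, mul_assoc])
  have hLQ : ¬ L ∣ Q := by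
    rintro ⟨q, hq⟩
    obtain ⟨q, hqh, hq⟩ := exists_homog_quot (m := 1) (n := 3) hQh hLh hq
    obtain ⟨r, hr, hqr⟩ := conic_dvd_cubic (fun i : Fin 7 => x (Fin.castLE (by norm_num) i))
      (fun i j h => Fin.castLE_injective _ (hx h)) hCirr hCh hqh
      (fun i => (hCv _).2 (by simp)) (fun i => by
        have h := hQx (Fin.castLE (by norm_num) i)
        rw [hq, map_mul] at h
        refine (mul_eq_zero.1 h).resolve_left fun h' => ?_
        have := ((hLv _).1 h').1
        simp only [Fin.val_castLE] at this
        omega)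
    exact hfin r hr (by rw [hq, hqr]; ring)
  obtain ⟨u, hu⟩ := exists_eval_ne hQ0
  obtain ⟨l, hl0, hlh, hl11, hlu⟩ := exists_line (x 11).rep u
  have hlQ : ¬ l ∣ Q := by
    rintro ⟨q, hq⟩
    exact hu (by rw [hq, map_mul, hlu, zero_mul])
  have hP0 : C * L * l ≠ 0 := mul_ne_zero (mul_ne_zero hCirr.ne_zero hL) hl0
  have hPh : (C * L * l).IsHomogeneous 4 := (hCh.mul hLh).mul hlh
  refine ⟨C * L * l, Q, hP0, hQ0, hPh, hQh, ?_, ?_⟩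
  · rintro ⟨h, hdeg, hhP, hhQ⟩
    have hh0 : h ≠ 0 := by rintro rfl; simp at hdeg
    have hhu : ¬ IsUnit h := by
      intro hun
      obtain ⟨c, -, hc⟩ := MvPolynomial.isUnit_iff_eq_C_of_isReduced.1 hun
      rw [hc, totalDegree_C] at hdeg
      exact lt_irrefl _ hdeg
    obtain ⟨r, hr, hrh⟩ := WfDvdMonoid.exists_irreducible_factor hhu hh0
    have hrp := hr.prime
    have hrQ := hrh.trans hhQ
    rcases hrp.dvd_or_dvd (hrh.trans hhP) with h1 | h1
    · rcases hrp.dvd_or_dvd h1 with h2 | h2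
      · exact hCQ (((hr.associated_of_dvd hCirr h2).symm.dvd).trans hrQ)
      · exact hLQ (((hr.associated_of_dvd (irr_of_linear hL hLh) h2).symm.dvd).trans hrQ)
    · exact hlQ (((hr.associated_of_dvd (irr_of_linear hl0 hlh) h1).symm.dvd).trans hrQ)
  · have hPx : ∀ i, eval (x i).rep (C * L * l) = 0 := by
      intro i
      rw [map_mul, map_mul]
      rcases lt_or_ge (i : ℕ) 7 with h | h
      · rw [(hCv i).2 h]; ring
      · rcases lt_or_ge (i : ℕ) 11 with h' | h'
        · rw [(hLv i).2 ⟨h, h'⟩]; ring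
        · have : i = 11 := by
            apply Fin.ext
            have := i.2
            change (i : ℕ) = 11
            omega
          rw [this, hl11, mul_zero]
    classical
    have hset : (Set.range x ∪ {p} : Set _) =
        ↑(Finset.univ.image x ∪ {p} : Finset (Projectivization ℂ (Fin 3 → ℂ))) := by
      simp
    rw [hset, finsum_mem_coe_finset]
    calc 12 = ∑ y ∈ Finset.univ.image x, 1 := by
          rw [Finset.sum_const, Finset.card_image_of_injective _ hx]; simp
      _ ≤ ∑ y ∈ Finset.univ.image x, min (ordAt (C * L * l) y) (ordAt Q y) := by
          refine Finset.sum_le_sum fun y hy => ?_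
          obtain ⟨i, -, rfl⟩ := Finset.mem_image.1 hy
          exact le_min (one_le_ordAt hP0 hPh _ (hPx i)) (one_le_ordAt hQ0 hQh _ (hQx i))
      _ ≤ _ := Finset.sum_le_sum_of_subset Finset.subset_union_left
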